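/- arXiv:1507.02451 — 2 statements merged into one kernel-verified Lean document; each statement's English description precedes it below -/
import Mathlib

section
/- Let μ > 0, α ∈ (0,1/2], ε ∈ (0,1], C₀ > 0, and let θ : [−1,1] → ℝ be an integrable odd function with |θ(ρ)| ≤ C₀·ε^α for all ρ. Let g : ℝ → ℝ be four times continuously differentiable with sup|g⁗| ≤ K, and set ξ_ε = (μ·ε^(−2α)/2)·∫_{−1}^{1} θ(ρ)² dρ. Then for every φ ∈ ℝ: | μ·ε^(−2α)·∫_{−1}^{1} ( g(φ + θ(ρ)) − g(φ) ) dρ − ξ_ε·g''(φ) | ≤ (C₀⁴/12)·μ·K·ε^(2α). -/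
open MeasureTheory

/-- Taylor expansion of order three with the Lagrange bound on the remainder. -/
theorem abs_taylor_three_remainder_le {g : ℝ → ℝ} {K : ℝ} (hg : ContDiff ℝ 4 g)
    (hK : ∀ x : ℝ, |iteratedDeriv 4 g x| ≤ K) (x t : ℝ) :
    |g (x + t) - g x - t * iteratedDeriv 1 g x - t ^ 2 / 2 * iteratedDeriv 2 g x
      - t ^ 3 / 6 * iteratedDeriv 3 g x| ≤ K * t ^ 4 / 24 := by
  rcases eq_or_ne t 0 with rfl | ht
  · simp
  have hne : x ≠ x + t := by simpa using ht
  have hu : UniqueDiffOn ℝ (Set.uIcc x (x + t)) := uniqueDiffOn_uIcc hne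
  have hd : ∀ k : ℕ, k ≤ 4 → ∀ y ∈ Set.uIcc x (x + t),
      iteratedDerivWithin k g (Set.uIcc x (x + t)) y = iteratedDeriv k g y := fun k hk y hy =>
    iteratedDerivWithin_eq_iteratedDeriv hu (hg.of_le (by exact_mod_cast hk)).contDiffAt hy
  obtain ⟨y, hy, h⟩ := taylor_mean_remainder_lagrange (f := g) (n := 3) hne
    (hg.of_le (by norm_num)).contDiffOn
    ((hg.contDiffOn.differentiableOn_iteratedDerivWithin (by norm_num) hu).mono
      Set.uIoo_subset_uIcc_self)
  have hx : x ∈ Set.uIcc x (x + t) := Set.left_mem_uIcc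
  simp only [taylorWithinEval_succ, taylor_within_zero_eval] at h
  norm_num [hd 1 (by norm_num) x hx, hd 2 (by norm_num) x hx, hd 3 (by norm_num) x hx,
    hd 4 le_rfl y (Set.uIoo_subset_uIcc_self hy), Nat.factorial] at h
  have key : g (x + t) - g x - t * iteratedDeriv 1 g x - t ^ 2 / 2 * iteratedDeriv 2 g x
      - t ^ 3 / 6 * iteratedDeriv 3 g x = iteratedDeriv 4 g y * t ^ 4 / 24 := by
    rw [← h, ← iteratedDeriv_one]
    ring
  rw [key, abs_div, abs_mul, abs_of_nonneg (by positivity : 0 ≤ t ^ 4),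
    abs_of_pos (by norm_num : (0 : ℝ) < 24)]
  gcongr
  exact hK y

/-- The integral of an odd function over a symmetric interval vanishes. -/
theorem intervalIntegral_eq_zero_of_odd {f : ℝ → ℝ} (hf : ∀ x, f (-x) = -f x) (a : ℝ) :
    ∫ x in (-a)..a, f x = 0 := by
  have h := intervalIntegral.integral_comp_neg (a := -a) (b := a) f
  simp only [hf, intervalIntegral.integral_neg, neg_neg] at h
  linarith

/-- Composing a continuous function with a bounded integrable function yields an integrable
function on a bounded interval. -/
theorem IntervalIntegrable.continuous_comp_of_bounded {f θ : ℝ → ℝ} {a b B : ℝ} (hf : Continuous f)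
    (hθ : IntervalIntegrable θ volume a b) (hB : ∀ x ∈ Set.uIcc a b, |θ x| ≤ B) :
    IntervalIntegrable (fun x => f (θ x)) volume a b := by
  obtain ⟨C, hC⟩ := (isCompact_Icc (a := -B) (b := B)).exists_bound_of_continuousOn hf.continuousOn
  rw [intervalIntegrable_iff] at hθ ⊢
  refine IntegrableOn.of_bound (by simp [Set.uIoc]) (hf.comp_aestronglyMeasurable hθ.aestronglyMeasurable) C ?_
  refine (ae_restrict_iff' measurableSet_uIoc).2 (.of_forall fun x hx => hC _ ?_)
  exact abs_le.1 (hB x (Set.uIoc_subset_uIcc hx))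

/-- Grazing-collision Taylor expansion at the heart of Proposition 3.4: the pre-limit
collision operator applied to a smooth function g equals ξ_ε g'' up to an error of order
ε^(2α). -/
theorem stmt_4 (μ α ε C₀ K : ℝ) (hμ : 0 < μ) (hα : α ∈ Set.Ioc (0 : ℝ) (1 / 2))
    (hε : ε ∈ Set.Ioc (0 : ℝ) 1) (hC₀ : 0 < C₀)
    (θ : ℝ → ℝ) (hθint : IntervalIntegrable θ volume (-1) 1)
    (hodd : ∀ ρ, θ (-ρ) = -θ ρ)
    (hθb : ∀ ρ ∈ Set.Icc (-1 : ℝ) 1, |θ ρ| ≤ C₀ * ε ^ α)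
    (g : ℝ → ℝ) (hg : ContDiff ℝ 4 g)
    (hK : ∀ x : ℝ, |iteratedDeriv 4 g x| ≤ K) :
    ∀ φ : ℝ,
      |μ * ε ^ (-(2 * α)) * (∫ ρ in (-1 : ℝ)..1, (g (φ + θ ρ) - g φ))
          - ((μ * ε ^ (-(2 * α)) / 2) * ∫ ρ in (-1 : ℝ)..1, (θ ρ) ^ 2) * deriv (deriv g) φ|
        ≤ (C₀ ^ 4 / 12) * μ * K * ε ^ (2 * α) := by
  intro φ
  set δ := ε ^ α with hδ
  have hδ0 : 0 < δ := Real.rpow_pos_of_pos hε.1 _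
  have hpow : ε ^ (2 * α) = δ ^ 2 := by
    rw [hδ, mul_comm, Real.rpow_mul hε.1.le, Real.rpow_two]
  rw [Real.rpow_neg hε.1.le, hpow]
  have hK0 : 0 ≤ K := (abs_nonneg _).trans (hK 0)
  have hI : ∀ f : ℝ → ℝ, Continuous f → IntervalIntegrable (fun ρ => f (θ ρ)) volume (-1) 1 :=
    fun f hf => IntervalIntegrable.continuous_comp_of_bounded hf hθint
      (by rwa [Set.uIcc_of_le (by norm_num)])
  have hgc := hg.continuous
  have hθ1 : ∫ ρ in (-1 : ℝ)..1, θ ρ = 0 := intervalIntegral_eq_zero_of_odd hodd 1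
  have hθ3 : ∫ ρ in (-1 : ℝ)..1, θ ρ ^ 3 = 0 :=
    intervalIntegral_eq_zero_of_odd (fun ρ => by rw [hodd]; ring) 1
  have hsplit : ∫ ρ in (-1 : ℝ)..1, (g (φ + θ ρ) - g φ - θ ρ * iteratedDeriv 1 g φ
      - θ ρ ^ 2 / 2 * iteratedDeriv 2 g φ - θ ρ ^ 3 / 6 * iteratedDeriv 3 g φ)
      = (∫ ρ in (-1 : ℝ)..1, (g (φ + θ ρ) - g φ))
        - (∫ ρ in (-1 : ℝ)..1, θ ρ ^ 2) / 2 * iteratedDeriv 2 g φ := by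
    rw [intervalIntegral.integral_sub
        (hI (fun t => g (φ + t) - g φ - t * iteratedDeriv 1 g φ - t ^ 2 / 2 * iteratedDeriv 2 g φ)
          (by fun_prop))
        (hI (fun t => t ^ 3 / 6 * iteratedDeriv 3 g φ) (by fun_prop)),
      intervalIntegral.integral_sub
        (hI (fun t => g (φ + t) - g φ - t * iteratedDeriv 1 g φ) (by fun_prop))
        (hI (fun t => t ^ 2 / 2 * iteratedDeriv 2 g φ) (by fun_prop)),
      intervalIntegral.integral_sub
        (hI (fun t => g (φ + t) - g φ) (by fun_prop))
        (hI (fun t => t * iteratedDeriv 1 g φ) (by fun_prop))]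
    simp only [intervalIntegral.integral_mul_const, intervalIntegral.integral_div, hθ1, hθ3]
    ring
  have hbound := intervalIntegral.norm_integral_le_of_norm_le_const (a := (-1 : ℝ)) (b := 1)
    (f := fun ρ => g (φ + θ ρ) - g φ - θ ρ * iteratedDeriv 1 g φ
      - θ ρ ^ 2 / 2 * iteratedDeriv 2 g φ - θ ρ ^ 3 / 6 * iteratedDeriv 3 g φ)
    (C := K * (C₀ * δ) ^ 4 / 24) fun ρ hρ => by
      refine (abs_taylor_three_remainder_le hg hK φ (θ ρ)).trans ?_
      rw [← (by decide : Even 4).pow_abs (θ ρ)]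
      rw [Set.uIoc_of_le (by norm_num)] at hρ
      gcongr
      exact hθb ρ (Set.Ioc_subset_Icc_self hρ)
  rw [hsplit, Real.norm_eq_abs, iteratedDeriv_succ, iteratedDeriv_one] at hbound
  norm_num at hbound
  calc _ = |μ * (δ ^ 2)⁻¹ * ((∫ ρ in (-1 : ℝ)..1, (g (φ + θ ρ) - g φ))
        - (∫ ρ in (-1 : ℝ)..1, θ ρ ^ 2) / 2 * deriv (deriv g) φ)| := by
        congr 1
        ring
    _ ≤ μ * (δ ^ 2)⁻¹ * (K * (C₀ * δ) ^ 4 / 24 * 2) := by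
        rw [abs_mul, abs_of_pos (by positivity : 0 < μ * (δ ^ 2)⁻¹)]
        gcongr
    _ = _ := by
        field_simp
        ring
end

section
/- Let Q ≥ 1 be an integer and 0 ≤ a ≤ t real numbers. With the convention t₀ := t, the integral over the simplex { (t₁,…,t_Q) ∈ ℝ^Q : 0 ≤ t_Q ≤ t_{Q−1} ≤ … ≤ t₁ ≤ t } (with respect to Lebesgue measure) of the function Σ_{i=1}^{Q} 1(t_i < t_{i−1} − a) is at most ( 2·(t−a)^Q + a·(t−a)^(Q−1) ) / (Q−1)!. -/
open MeasureTheory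

/-- The simplex of points of `ℝ^n` with nonincreasing coordinates in `[0, s]`. -/
def antitoneSimplex (n : ℕ) (s : ℝ) : Set (Fin n → ℝ) :=
  {u | (∀ i, 0 ≤ u i) ∧ (∀ i, u i ≤ s) ∧ ∀ i j : Fin n, i ≤ j → u j ≤ u i}

theorem measurableSet_antitoneSimplex (n : ℕ) (s : ℝ) :
    MeasurableSet (antitoneSimplex n s) := by
  have h0 : IsClosed {u : Fin n → ℝ | ∀ i, 0 ≤ u i} := by
    simp only [Set.ofPred_forall]
    exact isClosed_iInter fun i => isClosed_le (by fun_prop) (by fun_prop)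
  have h1 : IsClosed {u : Fin n → ℝ | ∀ i, u i ≤ s} := by
    simp only [Set.ofPred_forall]
    exact isClosed_iInter fun i => isClosed_le (by fun_prop) (by fun_prop)
  have h2 : IsClosed {u : Fin n → ℝ | ∀ i j : Fin n, i ≤ j → u j ≤ u i} := by
    simp only [Set.ofPred_forall]
    exact isClosed_iInter fun i => isClosed_iInter fun j => isClosed_iInter fun _ =>
      isClosed_le (by fun_prop) (by fun_prop)
  exact (h0.inter (h1.inter h2)).measurableSet

theorem volume_antitoneSimplex_le (n : ℕ) {s : ℝ} (hs : 0 ≤ s) :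
    volume (antitoneSimplex n s) ≤ ENNReal.ofReal (s ^ n / n.factorial) := by
  induction n generalizing s with
  | zero =>
    refine (measure_mono (Set.subset_univ _)).trans ?_
    simp [volume_pi]
  | succ n ih =>
    have hmp := (volume_preserving_piFinSuccAbove (fun _ : Fin (n + 1) => ℝ) 0).symm
    rw [← hmp.measure_preimage (measurableSet_antitoneSimplex _ _).nullMeasurableSet,
      Measure.volume_eq_prod,
      Measure.prod_apply (hmp.measurable (measurableSet_antitoneSimplex _ _))]
    have hint : ∫⁻ x in Set.Icc 0 s, ENNReal.ofReal (x ^ n / n.factorial) =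
        ENNReal.ofReal (s ^ (n + 1) / (n + 1).factorial) := by
      rw [← ofReal_integral_eq_lintegral_ofReal]
      · congr 1
        rw [integral_Icc_eq_integral_Ioc, ← intervalIntegral.integral_of_le hs,
          intervalIntegral.integral_div, integral_pow, Nat.factorial_succ]
        push_cast
        field_simp
        simp
      · exact (by fun_prop : Continuous fun x : ℝ => x ^ n / n.factorial).integrableOn_Icc
      · filter_upwards [ae_restrict_mem measurableSet_Icc] with x hx
        have := hx.1
        positivity
    rw [← hint, ← lintegral_indicator measurableSet_Icc]
    refine lintegral_mono fun x => ?_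
    by_cases hx : x ∈ Set.Icc 0 s
    · rw [Set.indicator_of_mem hx]
      refine (measure_mono ?_).trans (ih hx.1)
      rintro v ⟨h0, -, h2⟩
      simp only [MeasurableEquiv.piFinSuccAbove_symm_apply, Fin.insertNthEquiv_zero,
        Fin.consEquiv_apply] at h0 h2
      exact ⟨fun i => by simpa using h0 i.succ, fun i => by simpa using h2 0 i.succ (Fin.zero_le _),
        fun i j hij => by simpa using h2 i.succ j.succ (Fin.succ_le_succ_iff.2 hij)⟩
    · rw [Set.indicator_of_notMem hx, nonpos_iff_eq_zero]
      refine measure_mono_null (t := ∅) ?_ measure_empty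
      rintro v ⟨h0, h1, -⟩
      simp only [MeasurableEquiv.piFinSuccAbove_symm_apply, Fin.insertNthEquiv_zero,
        Fin.consEquiv_apply] at h0 h1
      exact hx ⟨by simpa using h0 0, by simpa using h1 0⟩

/-- The coordinate preceding `u i`, with the convention that `t` precedes the first one. -/
def prevCoord {n : ℕ} (t : ℝ) (u : Fin n → ℝ) (i : Fin n) : ℝ :=
  if _ : (i : ℕ) = 0 then t else u ⟨(i : ℕ) - 1, lt_of_le_of_lt (Nat.sub_le _ _) i.isLt⟩

theorem measurable_prevCoord {n : ℕ} (t : ℝ) (i : Fin n) :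
    Measurable fun u : Fin n → ℝ => prevCoord t u i := by
  unfold prevCoord
  split_ifs <;> fun_prop

theorem prevCoord_le {n : ℕ} {t : ℝ} {u : Fin n → ℝ} (hu : u ∈ antitoneSimplex n t)
    (i : Fin n) : prevCoord t u i ≤ t := by
  unfold prevCoord
  split_ifs
  exacts [le_rfl, hu.2.1 _]

theorem prevCoord_le_of_lt {n : ℕ} {t : ℝ} {u : Fin n → ℝ} (hu : u ∈ antitoneSimplex n t)
    {i j : Fin n} (hji : j < i) : prevCoord t u i ≤ u j := by
  have : (j : ℕ) < i := hji
  rw [prevCoord, dif_neg (by omega)]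
  exact hu.2.2 _ _ (Fin.le_def.2 (by simp only; omega))

/-- Subtracting `a` from the coordinates before a gap of length more than `a` sends the simplex
of size `t` to the simplex of size `t - a`. -/
theorem volume_gap_inter_antitoneSimplex_le {n : ℕ} {a t : ℝ} (hat : a ≤ t)
    (i : Fin n) :
    volume ({u | u i < prevCoord t u i - a} ∩ antitoneSimplex n t) ≤
      ENNReal.ofReal ((t - a) ^ n / n.factorial) := by
  let c : Fin n → ℝ := fun j => if j < i then -a else 0
  refine le_trans ?_ (volume_antitoneSimplex_le n (sub_nonneg.2 hat))
  rw [← measure_preimage_add_right volume c (antitoneSimplex n (t - a))]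
  refine measure_mono ?_
  rintro u ⟨hgap, hu⟩
  have hgap : u i < prevCoord t u i - a := hgap
  have hi := hu.1 i
  have hp := prevCoord_le hu i
  refine ⟨fun j => ?_, fun j => ?_, fun j k hjk => ?_⟩ <;> simp only [Pi.add_apply, c]
  · split_ifs with hj
    · linarith [prevCoord_le_of_lt hu hj]
    · linarith [hu.1 j]
  · split_ifs with hj
    · linarith [hu.2.1 j]
    · linarith [hu.2.2 i j (not_lt.1 hj)]
  · have hkj := hu.2.2 j k hjk
    split_ifs with hk hj hj
    · linarith
    · exact absurd (hjk.trans_lt hk) hj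
    · linarith [prevCoord_le_of_lt hu hj, hu.2.2 i k (not_lt.1 hk)]
    · linarith

/-- The simplex bound (4.7) in the proof of Proposition 4.1: the Lebesgue volume (weighted
by the number of inter-collision gaps exceeding a) of the simplex of ordered collision
times is at most (2(t−a)^Q + a(t−a)^(Q−1))/(Q−1)!. The convention is t₀ := t. -/
theorem stmt_7 (Q : ℕ) (hQ : 1 ≤ Q) (a t : ℝ) (ha : 0 ≤ a) (hat : a ≤ t) :
    (∫ u : Fin Q → ℝ in
        {u : Fin Q → ℝ | (∀ i, 0 ≤ u i) ∧ (∀ i, u i ≤ t) ∧ ∀ i j : Fin Q, i ≤ j → u j ≤ u i},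
        ∑ i : Fin Q,
          (if u i < (if _ : (i : ℕ) = 0 then t
              else u ⟨(i : ℕ) - 1, lt_of_le_of_lt (Nat.sub_le _ _) i.isLt⟩) - a
            then (1 : ℝ) else 0))
      ≤ (2 * (t - a) ^ Q + a * (t - a) ^ (Q - 1)) / Nat.factorial (Q - 1) := by
  change ∫ u in antitoneSimplex Q t, ∑ i : Fin Q,
    (if u i < prevCoord t u i - a then (1 : ℝ) else 0) ≤ _
  have hs : 0 ≤ t - a := sub_nonneg.2 hat
  have hmeas (i : Fin Q) : MeasurableSet {u : Fin Q → ℝ | u i < prevCoord t u i - a} :=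
    measurableSet_lt (by fun_prop) ((measurable_prevCoord t i).sub_const a)
  have : IsFiniteMeasure (volume.restrict (antitoneSimplex Q t)) :=
    isFiniteMeasure_restrict.2
      ((volume_antitoneSimplex_le Q (ha.trans hat)).trans_lt ENNReal.ofReal_lt_top).ne
  have hind (i : Fin Q) : (fun u : Fin Q → ℝ => if u i < prevCoord t u i - a then (1 : ℝ) else 0) =
      {u : Fin Q → ℝ | u i < prevCoord t u i - a}.indicator 1 := by
    ext u
    simp [Set.indicator_apply]
  have hgap (i : Fin Q) :
      ∫ u in antitoneSimplex Q t, (if u i < prevCoord t u i - a then (1 : ℝ) else 0) ≤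
        (t - a) ^ Q / Q.factorial := by
    rw [hind, integral_indicator_one (hmeas i), measureReal_def, Measure.restrict_apply (hmeas i)]
    exact ENNReal.toReal_le_of_le_ofReal (by positivity)
      (volume_gap_inter_antitoneSimplex_le hat i)
  rw [integral_finsetSum _ fun i _ => by
    rw [hind]; exact (integrable_const (1 : ℝ)).indicator (hmeas i)]
  refine (Finset.sum_le_sum fun i _ => hgap i).trans ?_
  obtain ⟨n, rfl⟩ := Nat.exists_eq_add_of_le' hQ
  rw [Finset.sum_const, Finset.card_univ, Fintype.card_fin, nsmul_eq_mul, Nat.factorial_succ,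
    Nat.add_sub_cancel]
  calc ((n + 1 : ℕ) : ℝ) * ((t - a) ^ (n + 1) / ((n + 1) * n.factorial : ℕ))
      = (t - a) ^ (n + 1) / n.factorial := by
        push_cast
        field_simp
    _ ≤ _ := by
        gcongr
        have : 0 ≤ (t - a) ^ (n + 1) := by positivity
        have : 0 ≤ a * (t - a) ^ n := by positivity
        linarith
end
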